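/- Let d ≥ 1 be an integer, let h be the order of a Hadamard matrix, let n = h + d, and suppose h ≥ h₀(d) := (e·(π/2)^{d/2}·(d−1)! + d)². Then D(n)/h^{h/2} > (2n/π)^{d/2}. -/

import Mathlib

/-- An `h × h` Hadamard matrix: entries in `{−1, 1}` and `A * Aᵀ = h • I`. -/
def IsHadamardMatrix {h : ℕ} (A : Matrix (Fin h) (Fin h) ℝ) : Prop :=
  (∀ i j, A i j = 1 ∨ A i j = -1) ∧ A * A.transpose = (h : ℝ) • 1

/-- `h` is the order of some Hadamard matrix. -/
def IsHadamardOrder (h : ℕ) : Prop :=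
  ∃ A : Matrix (Fin h) (Fin h) ℝ, IsHadamardMatrix A

/-- `maxDet n = D(n)`: the maximum of `|det M|` over `n × n` `{±1}`-matrices `M`. -/
noncomputable def maxDet (n : ℕ) : ℝ :=
  sSup {x : ℝ | ∃ M : Matrix (Fin n) (Fin n) ℝ,
    (∀ i j, M i j = 1 ∨ M i j = -1) ∧ x = |M.det|}

/-- `maxDetBar n = D̄(n) = D(n) / n^(n/2)`. -/
noncomputable def maxDetBar (n : ℕ) : ℝ :=
  maxDet n / (n : ℝ) ^ ((n : ℝ) / 2)

open Finset in
lemma sum_units_apply_sum {R : Type*} [CommSemiring R] (f : ℤ → R) (h : ℕ) :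
    ∑ x : Fin h → ℤˣ, f (∑ i, (x i : ℤ)) =
      ∑ ij ∈ antidiagonal h, (h.choose ij.1 : R) * f (ij.1 - ij.2) := by
  induction h generalizing f with
  | zero => simp
  | succ h ih =>
    have key : ∑ x : Fin (h + 1) → ℤˣ, f (∑ i, (x i : ℤ)) =
        ∑ x : Fin h → ℤˣ, f (-1 + ∑ i, (x i : ℤ)) + ∑ x : Fin h → ℤˣ, f (1 + ∑ i, (x i : ℤ)) := by
      rw [← (Fin.consEquiv fun _ => ℤˣ).sum_comp, Fintype.sum_prod_type]
      simp [Fin.sum_univ_succ, Fin.consEquiv, add_comm]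
    have h2 := sum_antidiagonal_choose_succ_mul (fun i j => f ((i : ℤ) - j)) h
    rw [key, h2, ih (fun t => f (-1 + t)), ih (fun t => f (1 + t))]
    congr 1
    · refine sum_congr rfl fun ij _ => ?_
      congr 2; push_cast; ring
    · refine sum_congr rfl fun ij hij => ?_
      rw [Nat.choose_symm_of_eq_add (mem_antidiagonal.1 hij).symm]
      congr 2; push_cast; ring

lemma sum_units_abs_sum_succ (h : ℕ) :
    ∑ x : Fin (h + 1) → ℤˣ, |∑ i, (x i : ℤ)| =
      2 * ∑ x : Fin h → ℤˣ, |∑ i, (x i : ℤ)| +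
        2 * ∑ x : Fin h → ℤˣ, if ∑ i, (x i : ℤ) = 0 then 1 else 0 := by
  rw [← (Fin.consEquiv fun _ => ℤˣ).sum_comp, Fintype.sum_prod_type, Finset.sum_comm,
    Finset.mul_sum, Finset.mul_sum, ← Finset.sum_add_distrib]
  refine Finset.sum_congr rfl fun x _ => ?_
  simp only [Fin.consEquiv, Fin.sum_univ_succ, Equiv.coe_fn_mk, Fin.cons_zero, Fin.cons_succ]
  generalize ∑ i, (x i : ℤ) = t
  rw [show (Finset.univ : Finset ℤˣ) = {1, -1} from rfl, Finset.sum_pair (by decide)]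
  simp only [Units.val_one, Units.val_neg]
  split_ifs with ht
  · simp [ht]
  · rcases lt_or_gt_of_ne ht with ht | ht
    · rw [abs_of_nonpos (by omega), abs_of_nonpos (by omega), abs_of_nonpos (by omega)]; ring
    · rw [abs_of_nonneg (by omega), abs_of_nonneg (by omega), abs_of_nonneg (by omega)]; ring

open Finset in
lemma sum_units_abs_sum_two_mul (m : ℕ) :
    ∑ x : Fin (2 * m) → ℤˣ, |∑ i, (x i : ℤ)| = 2 * m * m.centralBinom := by
  induction m with
  | zero => simp
  | succ m ih =>
    have h0 : (∑ x : Fin (2 * m) → ℤˣ, if ∑ i, (x i : ℤ) = 0 then (1 : ℤ) else 0) =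
        m.centralBinom := by
      rw [sum_units_apply_sum (fun t => if t = 0 then (1 : ℤ) else 0), sum_eq_single (m, m)]
      · simp [Nat.centralBinom]
      · rintro ⟨i, j⟩ hij hne
        have := mem_antidiagonal.1 hij
        simp only [ne_eq, Prod.mk.injEq] at this hne
        rw [if_neg (by simp only; omega), mul_zero]
      · intro hm
        exact absurd (Finset.HasAntidiagonal.mem_antidiagonal.2 (two_mul m).symm) hm
    have h1 : (∑ x : Fin (2 * m + 1) → ℤˣ, if ∑ i, (x i : ℤ) = 0 then (1 : ℤ) else 0) = 0 := by
      rw [sum_units_apply_sum (fun t => if t = 0 then (1 : ℤ) else 0)]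
      refine sum_eq_zero fun ij hij => ?_
      have := mem_antidiagonal.1 hij
      rw [if_neg (by omega), mul_zero]
    have h2 : ((m : ℤ) + 1) * (m + 1).centralBinom = 2 * (2 * m + 1) * m.centralBinom := by
      exact_mod_cast Nat.succ_mul_centralBinom_succ m
    rw [show 2 * (m + 1) = 2 * m + 1 + 1 by ring, sum_units_abs_sum_succ, sum_units_abs_sum_succ,
      ih, h0, h1]
    push_cast
    linear_combination -2 * h2

lemma centralBinom_sq_lower_bound (m : ℕ) :
    2 * 4 ^ (2 * m) ≤ Real.pi * (2 * m + 1) * (m.centralBinom : ℝ) ^ 2 := by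
  have h1 := Real.Wallis.W_le m
  rw [Real.Wallis.W_eq_factorial_ratio, div_le_iff₀ (by positivity)] at h1
  have h2 : (m.centralBinom : ℝ) * (m.factorial : ℝ) ^ 2 = ((2 * m).factorial : ℝ) := by
    have := Nat.choose_mul_factorial_mul_factorial (show m ≤ 2 * m by omega)
    rw [show 2 * m - m = m by omega, ← Nat.centralBinom_eq_two_mul_choose] at this
    rw [sq, ← mul_assoc]
    exact_mod_cast this
  rw [← h2, show (2 : ℝ) ^ (4 * m) = 4 ^ (2 * m) by
    rw [show (4 : ℝ) = 2 ^ 2 by norm_num, ← pow_mul]; congr 1; ring] at h1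
  have hf : (0 : ℝ) < (m.factorial : ℝ) ^ 4 := by positivity
  refine le_of_mul_le_mul_right ?_ hf
  nlinarith [h1]

lemma sum_units_abs_sum_lower_bound {h : ℕ} (hh : Even h) :
    2 ^ h * (h * √(2 / (Real.pi * (h + 1)))) ≤
      ∑ x : Fin h → ℤˣ, |∑ i, ((x i : ℤ) : ℝ)| := by
  obtain ⟨m, rfl⟩ := hh
  rw [← two_mul]
  have h1 : ∑ x : Fin (2 * m) → ℤˣ, |∑ i, ((x i : ℤ) : ℝ)| = 2 * m * m.centralBinom := by
    exact_mod_cast sum_units_abs_sum_two_mul m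
  have h2 : 2 ^ (2 * m) * √(2 / (Real.pi * ((2 * m : ℕ) + 1))) ≤ (m.centralBinom : ℝ) := by
    refine abs_le_of_sq_le_sq' ?_ (by positivity) |>.2
    rw [mul_pow, Real.sq_sqrt (by positivity), ← pow_mul, mul_comm (2 * m) 2, pow_mul,
      ← mul_div_assoc, div_le_iff₀ (by positivity)]
    have := centralBinom_sq_lower_bound m
    push_cast
    norm_num at this ⊢
    linarith
  rw [h1]
  calc _ = (2 * m : ℝ) * (2 ^ (2 * m) * √(2 / (Real.pi * ((2 * m : ℕ) + 1)))) := by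
        push_cast; ring
    _ ≤ _ := by gcongr

lemma le_maxDet {n : ℕ} {M : Matrix (Fin n) (Fin n) ℝ} (hM : ∀ i j, M i j = 1 ∨ M i j = -1) :
    |M.det| ≤ maxDet n := by
  refine le_csSup ⟨n.factorial • (1 : ℝ) ^ n, ?_⟩ ⟨M, hM, rfl⟩
  rintro _ ⟨N, hN, rfl⟩
  have := Matrix.det_le (A := N) (abv := AbsoluteValue.abs) (x := (1 : ℝ)) fun i j => by
    rcases hN i j with h | h <;> simp [h]
  simpa using this

lemma abs_det_le_maxDet {n : ℕ} (M : Matrix (Fin n) (Fin n) ℝ) (hM : ∀ i j, |M i j| ≤ 1) :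
    |M.det| ≤ maxDet n := by
  suffices H : ∀ (S : Finset (Fin n)) (M : Matrix (Fin n) (Fin n) ℝ), (∀ i j, |M i j| ≤ 1) →
      (∀ i ∉ S, ∀ j, M i j = 1 ∨ M i j = -1) → |M.det| ≤ maxDet n from
    H Finset.univ M hM (by simp)
  intro S
  induction S using Finset.induction_on with
  | empty => exact fun M _ h => le_maxDet fun i j => h i (by simp) j
  | insert i S hi ih =>
    intro M hM hS
    let L : (Fin n → ℝ) →ₗ[ℝ] ℝ :=
      (Matrix.detRowAlternating (R := ℝ)).toMultilinearMap.toLinearMap M i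
    have hL : ∀ r, L r = (M.updateRow i r).det := fun r => rfl
    have hconv : ConvexOn ℝ Set.univ fun r => |L r| := by
      simpa [Function.comp_def] using (convexOn_univ_norm (E := ℝ)).comp_linearMap L
    have hmem : M i ∈ convexHull ℝ (Set.univ.pi fun _ : Fin n => ({1, -1} : Set ℝ)) := by
      rw [convexHull_pi]
      intro j _
      rw [convexHull_pair, segment_symm, segment_eq_Icc (by norm_num)]
      exact abs_le.1 (hM i j)
    obtain ⟨r, hr, hle⟩ := hconv.exists_ge_of_mem_convexHull (Set.subset_univ _) hmem
    have hr' : ∀ j, r j = 1 ∨ r j = -1 := fun j => by simpa using hr j trivial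
    simp only [hL, Matrix.updateRow_eq_self] at hle
    refine hle.trans (ih _ (fun k j => ?_) fun k hk j => ?_)
    · by_cases hki : k = i
      · subst hki
        rcases hr' j with h | h <;> simp [h]
      · simpa [hki] using hM k j
    · by_cases hki : k = i
      · subst hki
        simpa using hr' j
      · simpa [hki] using hS k (by simp [hki, hk]) j

/-- The real vector underlying a vector of signs. -/
def signVec {h : ℕ} (x : Fin h → ℤˣ) : Fin h → ℝ := fun p => ((x p : ℤ) : ℝ)

lemma signVec_mul_self {h : ℕ} (x : Fin h → ℤˣ) (p : Fin h) : signVec x p * signVec x p = 1 := by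
  rcases Int.units_eq_one_or (x p) with hp | hp <;> simp [signVec, hp]

lemma abs_signVec {h : ℕ} (x : Fin h → ℤˣ) (p : Fin h) : |signVec x p| = 1 := by
  rcases Int.units_eq_one_or (x p) with hp | hp <;> simp [signVec, hp]

lemma abs_dotProduct_signVec_le {h : ℕ} {v : Fin h → ℝ} (hv : ∑ p, v p ^ 2 ≤ 1)
    (x : Fin h → ℤˣ) : |v ⬝ᵥ signVec x| ≤ √h := by
  refine Real.abs_le_sqrt ?_
  calc (v ⬝ᵥ signVec x) ^ 2 ≤ (∑ p, v p ^ 2) * ∑ p, signVec x p ^ 2 :=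
        Finset.sum_mul_sq_le_sq_mul_sq _ _ _
    _ ≤ 1 * h := by
        gcongr
        simp [sq, signVec_mul_self]
    _ = h := one_mul _

lemma sum_signVec_mul_signVec_eq_zero {d h : ℕ} (g : (Fin h → ℤˣ) → ℝ) {i j : Fin d}
    (hij : i ≠ j) {p q : Fin h} (hpq : p ≠ q) :
    ∑ b : Fin d → Fin h → ℤˣ, g (b i) * (signVec (b j) p * signVec (b j) q) = 0 := by
  let t : Fin d → Fin h → ℤˣ := Pi.mulSingle j (Pi.mulSingle p (-1))
  have h1 := Equiv.sum_comp (Equiv.mulRight t)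
    fun b : Fin d → Fin h → ℤˣ => g (b i) * (signVec (b j) p * signVec (b j) q)
  have h2 : ∀ b : Fin d → Fin h → ℤˣ,
      g ((b * t) i) * (signVec ((b * t) j) p * signVec ((b * t) j) q) =
        -(g (b i) * (signVec (b j) p * signVec (b j) q)) := by
    intro b
    simp [t, signVec, hij, hpq.symm]
  simp only [Equiv.coe_mulRight, h2, Finset.sum_neg_distrib] at h1
  linarith

lemma sum_dotProduct_signVec_sq_le {d h : ℕ} {w : (Fin h → ℤˣ) → Fin h → ℝ}
    (hw : ∀ x, ∑ p, w x p ^ 2 ≤ 1) {i j : Fin d} (hij : i ≠ j) :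
    ∑ b : Fin d → Fin h → ℤˣ, (w (b i) ⬝ᵥ signVec (b j)) ^ 2 ≤
      Fintype.card (Fin d → Fin h → ℤˣ) := by
  have key : ∑ b : Fin d → Fin h → ℤˣ, (w (b i) ⬝ᵥ signVec (b j)) ^ 2 =
      ∑ b : Fin d → Fin h → ℤˣ, ∑ p, w (b i) p ^ 2 := by
    simp only [dotProduct, sq, Finset.sum_mul_sum]
    rw [Finset.sum_comm, Finset.sum_comm (s := Finset.univ (α := Fin d → Fin h → ℤˣ))]
    refine Finset.sum_congr rfl fun p _ => ?_
    rw [Finset.sum_comm, Finset.sum_eq_single p]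
    · refine Finset.sum_congr rfl fun b _ => ?_
      linear_combination w (b i) p * w (b i) p * signVec_mul_self (b j) p
    · intro q _ hq
      rw [← sum_signVec_mul_signVec_eq_zero (fun x => w x p * w x q) hij hq.symm]
      exact Finset.sum_congr rfl fun b _ => by ring
    · simp
  rw [key]
  calc _ ≤ ∑ b : Fin d → Fin h → ℤˣ, (1 : ℝ) := Finset.sum_le_sum fun b _ => hw (b i)
    _ = _ := by simp

open Finset in
lemma abs_prod_le_of_abs_le {ι : Type*} [Fintype ι] [DecidableEq ι] {f : ι → ℝ} {s : ℝ}
    (hf : ∀ k, |f k| ≤ s) {i j : ι} (hij : i ≠ j) :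
    |∏ k, f k| ≤ (f i ^ 2 + f j ^ 2) / 2 * s ^ (Fintype.card ι - 2) := by
  have hj : j ∈ univ.erase i := by simp [hij.symm]
  rw [abs_prod, ← mul_prod_erase univ _ (mem_univ i), ← mul_prod_erase _ _ hj, ← mul_assoc]
  have h1 : |f i| * |f j| ≤ (f i ^ 2 + f j ^ 2) / 2 := by
    nlinarith [sq_nonneg (|f i| - |f j|), sq_abs (f i), sq_abs (f j)]
  have h2 : ∏ k ∈ (univ.erase i).erase j, |f k| ≤ s ^ (Fintype.card ι - 2) := by
    refine (prod_le_prod (fun _ _ => abs_nonneg _) fun k _ => hf k).trans_eq ?_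
    rw [prod_const, card_erase_of_mem hj, card_erase_of_mem (mem_univ i), card_univ]
    rfl
  exact mul_le_mul h1 h2 (prod_nonneg fun _ _ => abs_nonneg _) (by positivity)

/-- The matrix of inner products of the vectors `w (b i)` with the sign vectors `b j`. -/
def pairing {d h : ℕ} (w : (Fin h → ℤˣ) → Fin h → ℝ) (b : Fin d → Fin h → ℤˣ) :
    Matrix (Fin d) (Fin d) ℝ :=
  Matrix.of fun i j => w (b i) ⬝ᵥ signVec (b j)

lemma abs_sum_prod_perm_le {d h : ℕ} {w : (Fin h → ℤˣ) → Fin h → ℝ}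
    (hw : ∀ x, ∑ p, w x p ^ 2 ≤ 1) {σ : Equiv.Perm (Fin d)} (hσ : σ ≠ 1) :
    |∑ b : Fin d → Fin h → ℤˣ, ∏ i, (1 + pairing w b) (σ i) i| ≤
      Fintype.card (Fin d → Fin h → ℤˣ) * (√h + 1) ^ (d - 2) := by
  obtain ⟨i, hi⟩ : ∃ i, σ i ≠ i := by
    by_contra! H
    exact hσ (Equiv.ext H)
  have hi' : σ (σ i) ≠ σ i := fun H => hi (σ.injective H)
  have hentry : ∀ (b : Fin d → Fin h → ℤˣ) (k l), |(1 + pairing w b) k l| ≤ √h + 1 := by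
    intro b k l
    rw [Matrix.add_apply, add_comm]
    refine (abs_add_le _ _).trans (add_le_add (abs_dotProduct_signVec_le (hw _) _) ?_)
    rw [Matrix.one_apply]
    split_ifs <;> simp
  have hoff : ∀ (b : Fin d → Fin h → ℤˣ) {k l}, k ≠ l →
      (1 + pairing w b) k l = w (b k) ⬝ᵥ signVec (b l) := by
    intro b k l hkl
    simp [pairing, Matrix.one_apply_ne hkl]
  calc _ ≤ ∑ b : Fin d → Fin h → ℤˣ, |∏ i, (1 + pairing w b) (σ i) i| :=
        Finset.abs_sum_le_sum_abs _ _
    _ ≤ ∑ b : Fin d → Fin h → ℤˣ, ((w (b (σ i)) ⬝ᵥ signVec (b i)) ^ 2 +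
          (w (b (σ (σ i))) ⬝ᵥ signVec (b (σ i))) ^ 2) / 2 * (√h + 1) ^ (d - 2) := by
        refine Finset.sum_le_sum fun b _ => ?_
        have := abs_prod_le_of_abs_le (fun k => hentry b (σ k) k) hi.symm
        rwa [hoff b hi, hoff b hi', Fintype.card_fin] at this
    _ = (∑ b : Fin d → Fin h → ℤˣ, (w (b (σ i)) ⬝ᵥ signVec (b i)) ^ 2 +
          ∑ b : Fin d → Fin h → ℤˣ, (w (b (σ (σ i))) ⬝ᵥ signVec (b (σ i))) ^ 2) / 2 *
            (√h + 1) ^ (d - 2) := by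
        rw [← Finset.sum_add_distrib, Finset.sum_div, Finset.sum_mul]
    _ ≤ _ := by
        have h1 := sum_dotProduct_signVec_sq_le hw hi
        have h2 := sum_dotProduct_signVec_sq_le hw hi'
        gcongr
        linarith

lemma sum_det_one_add_pairing_ge {d h : ℕ} {w : (Fin h → ℤˣ) → Fin h → ℝ}
    (hw : ∀ x, ∑ p, w x p ^ 2 ≤ 1) :
    (∑ x, (1 + w x ⬝ᵥ signVec x)) ^ d - ((d.factorial : ℝ) - 1) *
        (Fintype.card (Fin d → Fin h → ℤˣ) * (√h + 1) ^ (d - 2)) ≤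
      ∑ b : Fin d → Fin h → ℤˣ, (1 + pairing w b).det := by
  simp only [Matrix.det_apply']
  rw [Finset.sum_comm, ← Finset.add_sum_erase Finset.univ _ (Finset.mem_univ (1 : Equiv.Perm (Fin d)))]
  have h1 : ∑ b : Fin d → Fin h → ℤˣ, (((Equiv.Perm.sign (1 : Equiv.Perm (Fin d)) : ℤˣ) : ℤ) : ℝ) *
      ∏ i, (1 + pairing w b) ((1 : Equiv.Perm (Fin d)) i) i =
        (∑ x, (1 + w x ⬝ᵥ signVec x)) ^ d := by
    rw [Finset.sum_pow']
    simp [pairing]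
  rw [h1, sub_eq_add_neg]
  gcongr
  have h2 : ∀ σ ∈ Finset.univ.erase (1 : Equiv.Perm (Fin d)),
      -(Fintype.card (Fin d → Fin h → ℤˣ) * (√h + 1) ^ (d - 2)) ≤
        ∑ b : Fin d → Fin h → ℤˣ, ((Equiv.Perm.sign σ : ℤ) : ℝ) *
          ∏ i, (1 + pairing w b) (σ i) i := by
    intro σ hσ
    rw [← Finset.mul_sum]
    refine neg_le_of_abs_le ?_
    rw [abs_mul]
    have := abs_sum_prod_perm_le hw (Finset.ne_of_mem_erase hσ)
    rcases Int.units_eq_one_or (Equiv.Perm.sign σ) with hs | hs <;> simpa [hs] using this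
  refine le_trans (le_of_eq ?_) (Finset.card_nsmul_le_sum _ _ _ h2)
  rw [Finset.card_erase_of_mem (Finset.mem_univ _), Finset.card_univ, Fintype.card_perm,
    Fintype.card_fin, nsmul_eq_mul, Nat.cast_pred d.factorial_pos]
  ring

lemma exists_det_one_add_pairing_ge {d h : ℕ} {w : (Fin h → ℤˣ) → Fin h → ℝ} {μ : ℝ}
    (hw : ∀ x, ∑ p, w x p ^ 2 ≤ 1) (hμ0 : 0 ≤ μ)
    (hμ : 2 ^ h * μ ≤ ∑ x, w x ⬝ᵥ signVec x) :
    ∃ b : Fin d → Fin h → ℤˣ, (1 + μ) ^ d - ((d.factorial : ℝ) - 1) * (√h + 1) ^ (d - 2) ≤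
      (1 + pairing w b).det := by
  have hcard : (Fintype.card (Fin d → Fin h → ℤˣ) : ℝ) = (2 ^ h) ^ d := by simp
  have h1 : 2 ^ h * (1 + μ) ≤ ∑ x, (1 + w x ⬝ᵥ signVec x) := by
    rw [Finset.sum_add_distrib]
    simp only [Finset.sum_const, Finset.card_univ, Fintype.card_pi, Fintype.card_units_int,
      Finset.prod_const, Fintype.card_fin, nsmul_eq_mul]
    push_cast
    linarith
  have h2 := sum_det_one_add_pairing_ge (d := d) hw
  have h3 : (2 ^ h * (1 + μ)) ^ d ≤ (∑ x, (1 + w x ⬝ᵥ signVec x)) ^ d := by gcongr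
  obtain ⟨b, -, hb⟩ := Finset.exists_le_of_sum_le (s := Finset.univ)
    (f := fun _ : Fin d → Fin h → ℤˣ =>
      (1 + μ) ^ d - ((d.factorial : ℝ) - 1) * (√h + 1) ^ (d - 2))
    (g := fun b => (1 + pairing w b).det) Finset.univ_nonempty (by
      rw [Finset.sum_const, Finset.card_univ, nsmul_eq_mul]
      refine le_trans (le_of_eq ?_) ((sub_le_sub_right h3 _).trans h2)
      rw [hcard, mul_pow]
      ring)
  exact ⟨b, hb⟩

lemma IsHadamardMatrix.transpose_mul_self {h : ℕ} {A : Matrix (Fin h) (Fin h) ℝ}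
    (hA : IsHadamardMatrix A) (h0 : h ≠ 0) : A.transpose * A = (h : ℝ) • 1 := by
  have h0' : (h : ℝ) ≠ 0 := by exact_mod_cast h0
  have h1 : A * ((h : ℝ)⁻¹ • A.transpose) = 1 := by
    rw [Matrix.mul_smul, hA.2, smul_smul, inv_mul_cancel₀ h0', one_smul]
  have h2 := mul_eq_one_comm.1 h1
  rw [Matrix.smul_mul] at h2
  rw [← h2, smul_smul, mul_inv_cancel₀ h0', one_smul]

lemma IsHadamardMatrix.abs_det {h : ℕ} {A : Matrix (Fin h) (Fin h) ℝ}
    (hA : IsHadamardMatrix A) : |A.det| = (h : ℝ) ^ ((h : ℝ) / 2) := by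
  have h1 := congrArg Matrix.det hA.2
  rw [Matrix.det_mul, Matrix.det_transpose, Matrix.det_smul, Matrix.det_one, mul_one,
    Fintype.card_fin] at h1
  rw [← Real.sqrt_sq_eq_abs, sq, h1, Real.sqrt_eq_rpow, ← Real.rpow_natCast, ← Real.rpow_mul
    (by positivity)]
  congr 1
  ring

lemma IsHadamardOrder.even {h : ℕ} (hH : IsHadamardOrder h) (h2 : 2 ≤ h) : Even h := by
  obtain ⟨A, hA⟩ := hH
  have h1 := congrFun (congrFun hA.2 ⟨0, by omega⟩) ⟨1, by omega⟩
  rw [Matrix.mul_apply, Matrix.smul_apply, Matrix.one_apply_ne (by simp), smul_zero] at h1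
  simp only [Matrix.transpose_apply] at h1
  set f := fun k => A ⟨0, by omega⟩ k * A ⟨1, by omega⟩ k
  have h3 : ∀ k, 1 + f k = 2 * if f k = 1 then (1 : ℝ) else 0 := by
    intro k
    have : f k = 1 ∨ f k = -1 := by
      rcases hA.1 ⟨0, by omega⟩ k with h | h <;> rcases hA.1 ⟨1, by omega⟩ k with h' | h' <;>
        simp [f, h, h']
    rcases this with h | h <;> norm_num [h]
  have h4 : (h : ℝ) = 2 * ((Finset.univ.filter fun k => f k = 1).card : ℝ) := by
    have : ∑ k, (1 + f k) = (h : ℝ) := by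
      rw [Finset.sum_add_distrib, h1]; simp
    rw [← this, Finset.sum_congr rfl fun k _ => h3 k, ← Finset.mul_sum]
    simp
  rw [even_iff_two_dvd]
  exact ⟨_, by exact_mod_cast h4⟩

/-- The vector of signs of the entries of `x ᵥ* A`. -/
noncomputable def signResponse {h : ℕ} (A : Matrix (Fin h) (Fin h) ℝ) (x : Fin h → ℤˣ) :
    Fin h → ℝ :=
  fun k => SignType.sign (Matrix.vecMul (signVec x) A k)

lemma abs_signResponse_le {h : ℕ} (A : Matrix (Fin h) (Fin h) ℝ) (x : Fin h → ℤˣ) (k : Fin h) :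
    |signResponse A x k| ≤ 1 := by
  unfold signResponse
  rcases SignType.sign (Matrix.vecMul (signVec x) A k) with _ | _ | _ <;> simp

/-- The vector dual to the signs of `x ᵥ* A`, normalized by the order. -/
noncomputable def dualVec {h : ℕ} (A : Matrix (Fin h) (Fin h) ℝ) (x : Fin h → ℤˣ) :
    Fin h → ℝ :=
  (h : ℝ)⁻¹ • A.mulVec (signResponse A x)

open Matrix in
lemma sum_dualVec_sq_le {h : ℕ} {A : Matrix (Fin h) (Fin h) ℝ} (hA : IsHadamardMatrix A)
    (h0 : h ≠ 0) (x : Fin h → ℤˣ) : ∑ p, dualVec A x p ^ 2 ≤ 1 := by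
  have h0' : (h : ℝ) ≠ 0 := by exact_mod_cast h0
  set c := signResponse A x
  have h1 : (A *ᵥ c) ⬝ᵥ (A *ᵥ c) = h * (c ⬝ᵥ c) := by
    rw [dotProduct_mulVec, ← mulVec_transpose, mulVec_mulVec, hA.transpose_mul_self h0]
    simp [smul_mulVec]
  have h2 : c ⬝ᵥ c ≤ h := by
    calc c ⬝ᵥ c ≤ ∑ _k : Fin h, (1 : ℝ) := Finset.sum_le_sum fun k _ => by
          rw [← sq, ← sq_abs]
          exact pow_le_one₀ (abs_nonneg _) (abs_signResponse_le A x k)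
      _ = h := by simp
  calc ∑ p, dualVec A x p ^ 2 = (h : ℝ)⁻¹ ^ 2 * ((A *ᵥ c) ⬝ᵥ (A *ᵥ c)) := by
        rw [dotProduct, Finset.mul_sum]
        refine Finset.sum_congr rfl fun p _ => ?_
        rw [dualVec, Pi.smul_apply, smul_eq_mul]
        ring
    _ ≤ (h : ℝ)⁻¹ ^ 2 * (h * h) := by rw [h1]; gcongr
    _ = 1 := by field_simp

open Matrix in
lemma dualVec_dotProduct_signVec {h : ℕ} (A : Matrix (Fin h) (Fin h) ℝ) (x y : Fin h → ℤˣ) :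
    dualVec A x ⬝ᵥ signVec y = (h : ℝ)⁻¹ * (signResponse A x ⬝ᵥ (signVec y ᵥ* A)) := by
  rw [dualVec, smul_dotProduct, smul_eq_mul, dotProduct_comm, dotProduct_mulVec, dotProduct_comm]

open Matrix in
lemma sum_abs_vecMul_eq {h : ℕ} {A : Matrix (Fin h) (Fin h) ℝ}
    (hA : ∀ i j, A i j = 1 ∨ A i j = -1) (k : Fin h) :
    ∑ x, |(signVec x ᵥ* A) k| = ∑ x : Fin h → ℤˣ, |∑ i, ((x i : ℤ) : ℝ)| := by
  classical
  let a : Fin h → ℤˣ := fun p => if A p k = 1 then 1 else -1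
  have ha : ∀ p, A p k = ((a p : ℤ) : ℝ) := by
    intro p
    rcases hA p k with h | h <;> norm_num [a, h]
  rw [← Equiv.sum_comp (Equiv.mulRight a) fun x : Fin h → ℤˣ => |∑ i, ((x i : ℤ) : ℝ)|]
  refine Finset.sum_congr rfl fun x _ => ?_
  simp [Matrix.vecMul, dotProduct, signVec, ha]

open Matrix in
lemma sum_dualVec_dotProduct_signVec {h : ℕ} {A : Matrix (Fin h) (Fin h) ℝ}
    (hA : ∀ i j, A i j = 1 ∨ A i j = -1) (h0 : h ≠ 0) :
    ∑ x, dualVec A x ⬝ᵥ signVec x = ∑ x : Fin h → ℤˣ, |∑ i, ((x i : ℤ) : ℝ)| := by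
  have h0' : (h : ℝ) ≠ 0 := by exact_mod_cast h0
  have h1 : ∀ x, dualVec A x ⬝ᵥ signVec x = (h : ℝ)⁻¹ * ∑ k, |(signVec x ᵥ* A) k| := by
    intro x
    rw [dualVec_dotProduct_signVec, dotProduct]
    simp only [signResponse, sign_mul_self]
  simp only [h1]
  rw [← Finset.mul_sum, Finset.sum_comm]
  simp only [sum_abs_vecMul_eq hA]
  simp [h0']

open Matrix in
lemma IsHadamardMatrix.det_pairing_le {d h : ℕ} {A : Matrix (Fin h) (Fin h) ℝ}
    (hA : IsHadamardMatrix A) (h0 : h ≠ 0) (b : Fin d → Fin h → ℤˣ) :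
    (h : ℝ) ^ ((h : ℝ) / 2) * (1 + pairing (dualVec A) b).det ≤ maxDet (h + d) := by
  have h0' : (h : ℝ) ≠ 0 := by exact_mod_cast h0
  let B : Matrix (Fin h) (Fin d) ℝ := Matrix.of fun p j => signVec (b j) p
  let C : Matrix (Fin d) (Fin h) ℝ := Matrix.of fun i k => signResponse A (b i) k
  let M := Matrix.fromBlocks A B C (-1)
  let _ : Invertible A := invertibleOfRightInverse A ((h : ℝ)⁻¹ • Aᵀ) (by
    rw [Matrix.mul_smul, hA.2, smul_smul, inv_mul_cancel₀ h0', one_smul])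
  have hinv : ⅟A = (h : ℝ)⁻¹ • Aᵀ := rfl
  have hpair : C * ⅟A * B = pairing (dualVec A) b := by
    ext i j
    rw [hinv, Matrix.mul_smul, Matrix.smul_mul, Matrix.smul_apply, Matrix.mul_assoc, pairing,
      Matrix.of_apply, dualVec_dotProduct_signVec, smul_eq_mul]
    congr 1
    simp [Matrix.mul_apply, dotProduct, Matrix.vecMul, B, C, mul_comm]
  have hdet : |M.det| = (h : ℝ) ^ ((h : ℝ) / 2) * |(1 + pairing (dualVec A) b).det| := by
    rw [Matrix.det_fromBlocks₁₁, hpair, abs_mul, hA.abs_det,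
      show -1 - pairing (dualVec A) b = -(1 + pairing (dualVec A) b) by abel, Matrix.det_neg,
      abs_mul, abs_pow, abs_neg, abs_one, one_pow, one_mul]
  have hM : ∀ i j, |M i j| ≤ 1 := by
    have hA1 : ∀ i j, |A i j| ≤ 1 := fun i j => by
      rcases hA.1 i j with h | h <;> simp [h]
    rintro (i | i) (j | j)
    · simpa [M] using hA1 i j
    · simpa [M, B] using (abs_signVec (b j) i).le
    · simpa [M, C] using abs_signResponse_le A (b i) j
    · simp only [M, Matrix.fromBlocks_apply₂₂, Matrix.neg_apply, abs_neg, Matrix.one_apply]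
      split_ifs <;> simp
  have := abs_det_le_maxDet (Matrix.reindex finSumFinEquiv finSumFinEquiv M)
    fun i j => hM _ _
  rw [Matrix.det_reindex_self, hdet] at this
  exact (mul_le_mul_of_nonneg_left (le_abs_self _) (by positivity)).trans this

theorem IsHadamardOrder.maxDet_ge {h : ℕ} (hH : IsHadamardOrder h) (h2 : 2 ≤ h) (d : ℕ) :
    (1 + h * √(2 / (Real.pi * (h + 1)))) ^ d - ((d.factorial : ℝ) - 1) * (√h + 1) ^ (d - 2) ≤
      maxDet (h + d) / (h : ℝ) ^ ((h : ℝ) / 2) := by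
  have heven := hH.even h2
  obtain ⟨A, hA⟩ := hH
  have h0 : h ≠ 0 := by omega
  obtain ⟨b, hb⟩ := exists_det_one_add_pairing_ge (d := d) (w := dualVec A)
    (sum_dualVec_sq_le hA h0) (by positivity)
    ((sum_units_abs_sum_lower_bound heven).trans_eq
      (sum_dualVec_dotProduct_signVec hA.1 h0).symm)
  refine hb.trans ?_
  rw [le_div_iff₀ (by positivity), mul_comm]
  exact hA.det_pairing_le h0 b

lemma exp_half_lt_one_add {x : ℝ} (h0 : 0 < x) (h1 : x < 1) : Real.exp (x / 2) < 1 + x := by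
  have h2 := Real.add_one_le_exp (-(x / 2))
  have h3 : Real.exp (x / 2) * Real.exp (-(x / 2)) = 1 := by
    rw [← Real.exp_add, add_neg_cancel, Real.exp_zero]
  have h4 := Real.exp_pos (x / 2)
  have h5 : Real.exp (x / 2) * (1 - x / 2) ≤ 1 := by nlinarith
  by_contra! h6
  nlinarith

lemma five_quarters_le_sqrt_pi_div_two : 5 / 4 ≤ √(Real.pi / 2) := by
  refine Real.le_sqrt_of_sq_le ?_
  have := Real.pi_gt_d2
  norm_num at this ⊢
  linarith

lemma sqrt_pi_div_two_mul_sqrt : √(Real.pi / 2) * √(2 / Real.pi) = 1 := by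
  rw [← Real.sqrt_mul (by positivity)]
  have := Real.pi_ne_zero
  rw [show Real.pi / 2 * (2 / Real.pi) = 1 by field_simp, Real.sqrt_one]

lemma sqrt_target_pow_le (d : ℕ) {s : ℝ} (hs : 0 < s) :
    √(2 * (s ^ 2 + d) / Real.pi) ^ d ≤
      (√(2 / Real.pi) * s) ^ d * Real.exp ((d / s) ^ 2 / 2) := by
  have h1 : √(2 * (s ^ 2 + d) / Real.pi) ≤ √(2 / Real.pi) * s * Real.exp (d / s ^ 2 / 2) := by
    refine Real.sqrt_le_iff.2 ⟨by positivity, ?_⟩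
    rw [mul_pow, mul_pow, Real.sq_sqrt (by positivity), ← Real.exp_nat_mul]
    have h2 := Real.add_one_le_exp ((d : ℝ) / s ^ 2)
    calc 2 * (s ^ 2 + d) / Real.pi = 2 / Real.pi * s ^ 2 * (d / s ^ 2 + 1) := by
          field_simp; ring
      _ ≤ 2 / Real.pi * s ^ 2 * Real.exp (d / s ^ 2) := by gcongr
      _ = _ := by congr 2; push_cast; ring
  calc _ ≤ (√(2 / Real.pi) * s * Real.exp (d / s ^ 2 / 2)) ^ d := by gcongr
    _ = _ := by
      rw [mul_pow, ← Real.exp_nat_mul]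
      congr 2
      ring

lemma main_term_ge (d : ℕ) {s : ℝ} (hs : 2 ≤ s) :
    (√(2 / Real.pi) * s) ^ d * (1 + d / s) ≤
      (1 + s ^ 2 * √(2 / (Real.pi * (s ^ 2 + 1)))) ^ d := by
  have hs0 : 0 < s := by linarith
  set α := √(2 / Real.pi) with hα
  have hα0 : 0 < α := by positivity
  have hβ := five_quarters_le_sqrt_pi_div_two
  have hαβ := sqrt_pi_div_two_mul_sqrt
  rw [← hα] at hαβ
  have h1 : α * 5 / 4 ≤ 1 := by nlinarith
  have h2 : √(s ^ 2 + 1) ≤ s + 1 / (2 * s) := by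
    refine Real.sqrt_le_iff.2 ⟨by positivity, ?_⟩
    have : (s + 1 / (2 * s)) ^ 2 = s ^ 2 + 1 + (1 / (2 * s)) ^ 2 := by field_simp; ring
    rw [this]
    nlinarith [sq_nonneg (1 / (2 * s))]
  have h3 : s - 1 / (2 * s) ≤ s ^ 2 / √(s ^ 2 + 1) := by
    rw [le_div_iff₀ (by positivity)]
    have h4 : 0 ≤ s - 1 / (2 * s) := by
      rw [sub_nonneg, div_le_iff₀ (by positivity)]; nlinarith
    calc _ ≤ (s - 1 / (2 * s)) * (s + 1 / (2 * s)) := by gcongr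
      _ = s ^ 2 - (1 / (2 * s)) ^ 2 := by ring
      _ ≤ s ^ 2 := by nlinarith [sq_nonneg (1 / (2 * s))]
  have h5 : s ^ 2 * √(2 / (Real.pi * (s ^ 2 + 1))) = α * (s ^ 2 / √(s ^ 2 + 1)) := by
    rw [← div_div, Real.sqrt_div (by positivity)]
    ring
  have h6 : 1 / (2 * s) ≤ 1 / 4 := by gcongr; linarith
  have h7 : α * s * (1 + 1 / s) ≤ 1 + s ^ 2 * √(2 / (Real.pi * (s ^ 2 + 1))) := by
    rw [h5]
    have h8 : α * s * (1 + 1 / s) = α * s + α := by field_simp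
    have h9 := mul_le_mul_of_nonneg_left h3 hα0.le
    have h10 := mul_le_mul_of_nonneg_left h6 hα0.le
    rw [h8]
    linarith
  have h8 : 1 + d / s ≤ (1 + 1 / s) ^ d := by
    have := one_add_mul_le_pow (show (-2 : ℝ) ≤ 1 / s by
      have : 0 < 1 / s := by positivity
      linarith) d
    rwa [mul_one_div] at this
  calc _ ≤ (α * s) ^ d * (1 + 1 / s) ^ d := by gcongr
    _ = (α * s * (1 + 1 / s)) ^ d := (mul_pow _ _ _).symm
    _ ≤ _ := by gcongr

lemma error_term_le {d : ℕ} {s : ℝ} (hd : 1 ≤ d)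
    (hs : Real.exp 1 * √(Real.pi / 2) ^ d * ((d - 1).factorial : ℝ) + d ≤ s) :
    ((d.factorial : ℝ) - 1) * (s + 1) ^ (d - 2) ≤
      (√(2 / Real.pi) * s) ^ d * (d * (s - d) / s ^ 2) := by
  have hE : 0 < Real.exp 1 * √(Real.pi / 2) ^ d * ((d - 1).factorial : ℝ) := by positivity
  have hsd : (d : ℝ) < s := by linarith
  have hs0 : 0 < s := lt_of_le_of_lt (by positivity) hsd
  obtain ⟨k, rfl⟩ : ∃ k, d = k + 1 := ⟨d - 1, by omega⟩
  rcases k with _ | k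
  · have : 0 < s - 1 := by simpa using hsd
    simp
    positivity
  have h1 : (1 + 1 / s) ^ k ≤ Real.exp 1 := by
    calc (1 + 1 / s) ^ k ≤ Real.exp (1 / s) ^ k := by
          gcongr
          linarith [Real.add_one_le_exp (1 / s)]
      _ = Real.exp (k / s) := by rw [← Real.exp_nat_mul]; congr 1; ring
      _ ≤ Real.exp 1 := by
          gcongr
          rw [div_le_one hs0]
          push_cast at hsd
          linarith
  have h2 : (s + 1) ^ k ≤ s ^ k * Real.exp 1 := by
    calc (s + 1) ^ k = s ^ k * (1 + 1 / s) ^ k := by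
          rw [← mul_pow]; congr 1; field_simp
      _ ≤ _ := by gcongr
  have hαβ := congrArg (· ^ (k + 2)) sqrt_pi_div_two_mul_sqrt
  simp only [mul_pow, one_pow] at hαβ
  simp only [show k + 1 + 1 = k + 2 from rfl, show k + 2 - 1 = k + 1 from rfl,
    show k + 2 - 2 = k from rfl] at hs ⊢
  have h3 : ((k + 2).factorial : ℝ) = (k + 2 : ℕ) * ((k + 1).factorial : ℝ) := by
    exact_mod_cast Nat.factorial_succ (k + 1)
  set α := √(2 / Real.pi)
  set β := √(Real.pi / 2)
  calc (((k + 2).factorial : ℝ) - 1) * (s + 1) ^ k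
      ≤ ((k + 2).factorial : ℝ) * (s ^ k * Real.exp 1) := by
        gcongr
        linarith
    _ = (α ^ (k + 2) * s ^ k * (k + 2 : ℕ)) *
          (Real.exp 1 * β ^ (k + 2) * ((k + 1).factorial : ℝ)) := by
        rw [h3]
        linear_combination (-((k + 2 : ℕ) * ((k + 1).factorial : ℝ) * s ^ k * Real.exp 1)) * hαβ
    _ ≤ (α ^ (k + 2) * s ^ k * (k + 2 : ℕ)) * (s - (k + 2 : ℕ)) := by
        gcongr
        linarith
    _ = _ := by
        rw [mul_pow]
        field_simp
        ring

lemma one_le_exp_one_mul_sqrt_pow_mul_factorial (d : ℕ) :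
    1 ≤ Real.exp 1 * √(Real.pi / 2) ^ d * ((d - 1).factorial : ℝ) := by
  have h1 : (1 : ℝ) ≤ √(Real.pi / 2) ^ d :=
    one_le_pow₀ (by linarith [five_quarters_le_sqrt_pi_div_two])
  have h2 : (1 : ℝ) ≤ ((d - 1).factorial : ℝ) := by exact_mod_cast (d - 1).factorial_pos
  have h3 : (1 : ℝ) ≤ Real.exp 1 := Real.one_le_exp (by norm_num)
  exact one_le_mul_of_one_le_of_one_le (one_le_mul_of_one_le_of_one_le h3 h1) h2

lemma sqrt_target_pow_lt {d : ℕ} {s : ℝ} (hd : 1 ≤ d)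
    (hs : Real.exp 1 * √(Real.pi / 2) ^ d * ((d - 1).factorial : ℝ) + d ≤ s) :
    √(2 * (s ^ 2 + d) / Real.pi) ^ d <
      (1 + s ^ 2 * √(2 / (Real.pi * (s ^ 2 + 1)))) ^ d -
        ((d.factorial : ℝ) - 1) * (s + 1) ^ (d - 2) := by
  have hE := one_le_exp_one_mul_sqrt_pow_mul_factorial d
  have hd' : (1 : ℝ) ≤ d := by exact_mod_cast hd
  have hs2 : 2 ≤ s := by linarith
  have hs0 : 0 < s := by linarith
  have hx1 : (d / s) ^ 2 < 1 := by
    rw [sq_lt_one_iff₀ (by positivity), div_lt_one hs0]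
    linarith
  have hP : 0 < (√(2 / Real.pi) * s) ^ d := by positivity
  calc _ ≤ (√(2 / Real.pi) * s) ^ d * Real.exp ((d / s) ^ 2 / 2) := sqrt_target_pow_le d hs0
    _ < (√(2 / Real.pi) * s) ^ d * (1 + (d / s) ^ 2) := by
        gcongr
        exact exp_half_lt_one_add (by positivity) hx1
    _ = (√(2 / Real.pi) * s) ^ d * (1 + d / s) -
          (√(2 / Real.pi) * s) ^ d * (d * (s - d) / s ^ 2) := by
        field_simp
        ring
    _ ≤ _ := sub_le_sub (main_term_ge d hs2) (error_term_le hd hs)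

theorem maxDet_lower_bound_large_h (d h n : ℕ) (hd : 1 ≤ d)
    (hH : IsHadamardOrder h) (hn : n = h + d)
    (hh : (h : ℝ) ≥
      (Real.exp 1 * (Real.pi / 2) ^ ((d : ℝ) / 2) * (Nat.factorial (d - 1) : ℝ)
        + (d : ℝ)) ^ 2) :
    maxDet n / (h : ℝ) ^ ((h : ℝ) / 2) > (2 * (n : ℝ) / Real.pi) ^ ((d : ℝ) / 2) := by
  subst hn
  have hpow : ∀ {a : ℝ}, 0 ≤ a → a ^ ((d : ℝ) / 2) = √a ^ d := fun {a} ha => by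
    rw [Real.sqrt_eq_rpow, ← Real.rpow_natCast, ← Real.rpow_mul ha]
    congr 1
    ring
  rw [hpow (by positivity)] at hh
  rw [hpow (by positivity)]
  have hs := Real.le_sqrt_of_sq_le hh
  have h2 : 2 ≤ h := by
    have h1 : (2 : ℝ) ≤ √h := by
      have hE := one_le_exp_one_mul_sqrt_pow_mul_factorial d
      have hd' : (1 : ℝ) ≤ d := by exact_mod_cast hd
      linarith
    have h3 : (2 : ℝ) ≤ h := by nlinarith [Real.sq_sqrt (Nat.cast_nonneg (α := ℝ) h)]
    exact_mod_cast h3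
  have hlt := sqrt_target_pow_lt hd hs
  rw [Real.sq_sqrt (Nat.cast_nonneg h)] at hlt
  push_cast
  exact hlt.trans_le (hH.maxDet_ge h2 d)
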